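/- arXiv:1509.03815 — 3 statements merged into one kernel-verified Lean document; each statement's English description precedes it below -/
import Mathlib

section
/- For every D ≥ 1, under a distributed unfair daemon, every execution of Algo_B(D) and every execution of Algo_HC(D) is finite: there is no infinite sequence of configurations γ_0, γ_1, γ_2, … such that γ_i ↦ γ_{i+1} is a step of the algorithm for all i. -/
open SimpleGraph

/-- A configuration: a distance value `d` and a parent pointer `par` per vertex. -/
structure Config (V : Type*) where
  d : V → ℕ
  par : V → V

/-- `Min_d(p)`: the minimum of the `d`-values of the neighbors of `p`. -/
noncomputable def minD {V : Type*} (G : SimpleGraph V) (γ : Config V) (p : V) : ℕ :=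
  sInf (γ.d '' {q | G.Adj p q})

def dOk {V : Type*} (G : SimpleGraph V) (γ : Config V) (p : V) : Prop :=
  γ.d p = minD G γ p + 1

def parOk {V : Type*} (γ : Config V) (p : V) : Prop :=
  γ.d p = γ.d (γ.par p) + 1

/-- A valid configuration of `Algo_U`: `d r = 0` and parent pointers are neighbors. -/
def ValidU {V : Type*} (G : SimpleGraph V) (r : V) (γ : Config V) : Prop :=
  γ.d r = 0 ∧ ∀ p, p ≠ r → G.Adj p (γ.par p)

/-- A valid configuration of the bounded algorithms: non-root `d`-values in `{1,…,D}`. -/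
def ValidB {V : Type*} (G : SimpleGraph V) (r : V) (D : ℕ) (γ : Config V) : Prop :=
  γ.d r = 0 ∧ ∀ p, p ≠ r → G.Adj p (γ.par p) ∧ 1 ≤ γ.d p ∧ γ.d p ≤ D

/-- Vertex `p` executes rule `U1` or `U2` in the step from `γ` to `γ'`:
`U1 : ¬dOk(p) → update(p)`, `U2 : dOk(p) ∧ ¬parOk(p) → par_p ← bestParent(p)`. -/
def execU {V : Type*} (G : SimpleGraph V) (γ γ' : Config V) (p : V) : Prop :=
  (¬ dOk G γ p ∧ γ'.d p = minD G γ p + 1 ∧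
    G.Adj p (γ'.par p) ∧ γ.d (γ'.par p) = minD G γ p) ∨
  (dOk G γ p ∧ ¬ parOk γ p ∧ γ'.d p = γ.d p ∧
    G.Adj p (γ'.par p) ∧ γ.d (γ'.par p) = minD G γ p)

/-- Vertex `p` executes one of the rules `B1`, `B2`, `B3` of `Algo_B(D)`. -/
def execB {V : Type*} (G : SimpleGraph V) (D : ℕ) (γ γ' : Config V) (p : V) : Prop :=
  (minD G γ p < D ∧ ¬ dOk G γ p ∧ γ'.d p = minD G γ p + 1 ∧
    G.Adj p (γ'.par p) ∧ γ.d (γ'.par p) = minD G γ p) ∨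
  (minD G γ p < D ∧ dOk G γ p ∧ ¬ parOk γ p ∧ γ'.d p = γ.d p ∧
    G.Adj p (γ'.par p) ∧ γ.d (γ'.par p) = minD G γ p) ∨
  (minD G γ p = D ∧ γ.d p ≠ D ∧ γ'.d p = D ∧ γ'.par p = γ.par p)

/-- Vertex `p` executes rule `HC1` or `HC2` of `Algo_HC(D)`. -/
def execHC {V : Type*} (G : SimpleGraph V) (D : ℕ) (γ γ' : Config V) (p : V) : Prop :=
  (¬ parOk γ p ∧ γ.d (γ.par p) < D ∧ γ'.d p = γ.d (γ.par p) + 1 ∧ γ'.par p = γ.par p) ∨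
  (minD G γ p < γ.d (γ.par p) ∧ γ'.d p = minD G γ p + 1 ∧
    G.Adj p (γ'.par p) ∧ γ.d (γ'.par p) = minD G γ p)

/-- Vertex `p` executes rule `HC2`: `d_{par_p} > Min_d(p) → update(p)`. -/
def execHC2 {V : Type*} (G : SimpleGraph V) (γ γ' : Config V) (p : V) : Prop :=
  minD G γ p < γ.d (γ.par p) ∧ γ'.d p = minD G γ p + 1 ∧
    G.Adj p (γ'.par p) ∧ γ.d (γ'.par p) = minD G γ p

/-- Vertex `p` executes rule `FHC1` or `HC2` of `Algo_FHC(D)`. -/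
def execFHC {V : Type*} (G : SimpleGraph V) (D : ℕ) (γ γ' : Config V) (p : V) : Prop :=
  (¬ parOk γ p ∧ γ.d (γ.par p) < D ∧ γ.d (γ.par p) = minD G γ p ∧
    γ'.d p = γ.d (γ.par p) + 1 ∧ γ'.par p = γ.par p) ∨
  execHC2 G γ γ' p

/-- A step of a distributed unfair daemon: a nonempty set `S` of (non-root) vertices,
each executing one of its enabled rules (as described by `exec`), all other vertices
keeping their state. -/
def StepWith {V : Type*} (r : V) (exec : Config V → Config V → V → Prop)
    (γ γ' : Config V) (S : Set V) : Prop :=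
  S.Nonempty ∧ (∀ p ∈ S, p ≠ r ∧ exec γ γ' p) ∧
    ∀ p ∉ S, γ'.d p = γ.d p ∧ γ'.par p = γ.par p

def Step {V : Type*} (r : V) (exec : Config V → Config V → V → Prop)
    (γ γ' : Config V) : Prop :=
  ∃ S : Set V, StepWith r exec γ γ' S

/-- Guard of the rules of `Algo_U` at `p`. -/
def guardU {V : Type*} (G : SimpleGraph V) (γ : Config V) (p : V) : Prop :=
  ¬ dOk G γ p ∨ (dOk G γ p ∧ ¬ parOk γ p)

/-- Guard of the rules of `Algo_B(D)` at `p`. -/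
def guardB {V : Type*} (G : SimpleGraph V) (D : ℕ) (γ : Config V) (p : V) : Prop :=
  (minD G γ p < D ∧ ¬ dOk G γ p) ∨
  (minD G γ p < D ∧ dOk G γ p ∧ ¬ parOk γ p) ∨
  (minD G γ p = D ∧ γ.d p ≠ D)

/-- Guard of the rules of `Algo_HC(D)` at `p`. -/
def guardHC {V : Type*} (G : SimpleGraph V) (D : ℕ) (γ : Config V) (p : V) : Prop :=
  (¬ parOk γ p ∧ γ.d (γ.par p) < D) ∨ minD G γ p < γ.d (γ.par p)

/-- Guard of the rules of `Algo_FHC(D)` at `p`. -/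
def guardFHC {V : Type*} (G : SimpleGraph V) (D : ℕ) (γ : Config V) (p : V) : Prop :=
  (¬ parOk γ p ∧ γ.d (γ.par p) < D ∧ γ.d (γ.par p) = minD G γ p) ∨
  minD G γ p < γ.d (γ.par p)

/-- A vertex is enabled when it is not the root and one of its guards holds. -/
def Enabled {V : Type*} (r : V) (guard : Config V → V → Prop) (γ : Config V) (p : V) : Prop :=
  p ≠ r ∧ guard γ p

/-- A terminal configuration: no vertex is enabled. -/
def Terminal {V : Type*} (r : V) (guard : Config V → V → Prop) (γ : Config V) : Prop :=
  ∀ p, ¬ Enabled r guard γ p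

/-- An execution (padded by stuttering once a terminal configuration is reached, so
that maximality is automatic): `e i` is the `i`-th configuration and `M i` the set of
vertices selected by the daemon at step `i`. -/
def IsExec {V : Type*} (r : V) (valid : Config V → Prop)
    (exec : Config V → Config V → V → Prop) (guard : Config V → V → Prop)
    (e : ℕ → Config V) (M : ℕ → Set V) : Prop :=
  (∀ i, valid (e i)) ∧
    ∀ i, (Terminal r guard (e i) ∧ e (i + 1) = e i ∧ M i = ∅) ∨
      StepWith r exec (e i) (e (i + 1)) (M i)

/-- Every vertex enabled in `e s` executes a rule or becomes neutralized in some step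
`j` with `s ≤ j < t`. -/
def Covers {V : Type*} (r : V) (guard : Config V → V → Prop)
    (e : ℕ → Config V) (M : ℕ → Set V) (s t : ℕ) : Prop :=
  ∀ p, Enabled r guard (e s) p →
    ∃ j, s ≤ j ∧ j < t ∧
      (p ∈ M j ∨ (Enabled r guard (e j) p ∧ ¬ Enabled r guard (e (j + 1)) p))

/-- `t` is the end of the round of execution `(e, M)` starting at index `s`:
the prefix from `s` to `t` is the minimal one in which every vertex enabled at `e s`
executes a rule or is neutralized. -/
def RoundEnd {V : Type*} (r : V) (guard : Config V → V → Prop)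
    (e : ℕ → Config V) (M : ℕ → Set V) (s t : ℕ) : Prop :=
  s ≤ t ∧ Covers r guard e M s t ∧ ∀ u, s ≤ u → Covers r guard e M s u → t ≤ u

theorem minD_le_of_adj {V : Type*} {G : SimpleGraph V} {γ : Config V} {p q : V}
    (h : G.Adj p q) : minD G γ p ≤ γ.d q :=
  Nat.sInf_le ⟨q, h, rfl⟩

theorem exists_adj_eq_minD {V : Type*} {G : SimpleGraph V} (γ : Config V) {p q : V}
    (h : G.Adj p q) : ∃ s, G.Adj p s ∧ γ.d s = minD G γ p :=
  Nat.sInf_mem (s := γ.d '' {s | G.Adj p s}) ⟨γ.d q, q, h, rfl⟩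

/-- Between `f` and `g`, no vertex with a value below `k` on either side changes its value. -/
def FrozenBelow {V : Type*} (k : ℕ) (f g : V → ℕ) : Prop :=
  ∀ p, f p < k ∨ g p < k → g p = f p

theorem FrozenBelow.minD_eq {V : Type*} {G : SimpleGraph V} {γ γ' : Config V} {k : ℕ} {p : V}
    (h : FrozenBelow k γ.d γ'.d) {q : V} (hq : G.Adj p q) (hk : minD G γ p < k) :
    minD G γ' p = minD G γ p := by
  obtain ⟨s, hs, hs'⟩ := exists_adj_eq_minD γ hq
  obtain ⟨t, ht, ht'⟩ := exists_adj_eq_minD γ' hq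
  have h₁ := h s (Or.inl (by omega))
  have h₂ := minD_le_of_adj (γ := γ') hs
  have h₃ := h t (Or.inr (by omega))
  have h₄ := minD_le_of_adj (γ := γ) ht
  omega

/-- If a vertex that enters level `k` while the lower levels are frozen satisfies an invariant
`J k` keeping it at level `k`, then every bounded set of levels is eventually frozen. -/
theorem eventually_frozenBelow {V : Type*} [Finite V] (f : ℕ → V → ℕ)
    (J : ℕ → V → ℕ → Prop) (hJ : ∀ k p i, J k p i → f i p = k)
    (enter : ∀ k p i, FrozenBelow k (f i) (f (i + 1)) → f i p ≠ k → f (i + 1) p = k →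
      J k p (i + 1))
    (keep : ∀ k p i, FrozenBelow k (f i) (f (i + 1)) → J k p i → J k p (i + 1)) (k : ℕ) :
    ∀ᶠ i in Filter.atTop, FrozenBelow k (f i) (f (i + 1)) := by
  induction k with
  | zero => exact Filter.Eventually.of_forall fun i p h => by omega
  | succ k ih =>
    have level : ∀ p, ∀ᶠ i in Filter.atTop, (f i p = k ↔ f (i + 1) p = k) := by
      intro p
      obtain ⟨N, hN⟩ := Filter.eventually_atTop.1 ih
      by_cases h : ∃ i, N ≤ i ∧ f i p ≠ k ∧ f (i + 1) p = k
      · obtain ⟨i, hi, h₁, h₂⟩ := h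
        have hstay : ∀ m, i + 1 ≤ m → J k p m := by
          intro m hm
          induction m, hm using Nat.le_induction with
          | base => exact enter k p i (hN i hi) h₁ h₂
          | succ m hm ihm => exact keep k p m (hN m (by omega)) ihm
        filter_upwards [Filter.eventually_ge_atTop (i + 1)] with m hm
        exact iff_of_true (hJ _ _ _ (hstay m hm)) (hJ _ _ _ (hstay (m + 1) (by omega)))
      · push Not at h
        by_cases h' : ∃ i, N ≤ i ∧ f i p ≠ k
        · obtain ⟨i, hi, h₁⟩ := h'
          have hstay : ∀ m, i ≤ m → f m p ≠ k := by
            intro m hm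
            induction m, hm using Nat.le_induction with
            | base => exact h₁
            | succ m hm ihm => exact h m (by omega) ihm
          filter_upwards [Filter.eventually_ge_atTop i] with m hm
          exact iff_of_false (hstay m hm) (hstay (m + 1) (by omega))
        · push Not at h'
          filter_upwards [Filter.eventually_ge_atTop N] with m hm
          exact iff_of_true (h' m hm) (h' (m + 1) (by omega))
    filter_upwards [ih, Filter.eventually_all.2 level] with i hi hlevel p hp
    have h₁ := hlevel p
    have h₂ := hi p
    omega

/-- Termination criterion: `J` is an invariant keeping newly entered levels stable, and a rule
execution in a step that leaves all values unchanged strictly improves the parent. -/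
theorem not_exists_infinite_execution {V : Type*} [Fintype V] {G : SimpleGraph V} {r : V} {D : ℕ}
    {exec : Config V → Config V → V → Prop} (J : ℕ → Config V → V → Prop)
    (hJ : ∀ k γ p, J k γ p → γ.d p = k)
    (enter : ∀ k γ γ' p, ValidB G r D γ → ValidB G r D γ' → Step r exec γ γ' →
      FrozenBelow k γ.d γ'.d → γ.d p ≠ k → γ'.d p = k → J k γ' p)
    (keep : ∀ k γ γ' p, ValidB G r D γ → ValidB G r D γ' → Step r exec γ γ' →
      FrozenBelow k γ.d γ'.d → J k γ p → J k γ' p)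
    (improve : ∀ γ γ' p, ValidB G r D γ → p ≠ r → exec γ γ' p → γ'.d = γ.d →
      γ'.d (γ'.par p) < γ.d (γ.par p)) :
    ¬ ∃ e : ℕ → Config V, (∀ i, ValidB G r D (e i)) ∧ ∀ i, Step r exec (e i) (e (i + 1)) := by
  rintro ⟨e, hvalid, hstep⟩
  have hle : ∀ i p, (e i).d p ≤ D := by
    intro i p
    rcases eq_or_ne p r with rfl | hp
    · simp [(hvalid i).1]
    · exact ((hvalid i).2 p hp).2.2
  obtain ⟨N, hN⟩ := Filter.eventually_atTop.1 <|
    eventually_frozenBelow (fun i => (e i).d) (fun k p i => J k (e i) p)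
      (fun k p i => hJ k (e i) p)
      (fun k p i => enter k _ _ p (hvalid i) (hvalid (i + 1)) (hstep i))
      (fun k p i => keep k _ _ p (hvalid i) (hvalid (i + 1)) (hstep i)) (D + 1)
  have hconst : ∀ i, N ≤ i → (e (i + 1)).d = (e i).d := fun i hi =>
    funext fun p => hN i hi p (Or.inl (Nat.lt_succ_of_le (hle i p)))
  refine not_strictAnti_of_wellFoundedLT
    (fun i => ∑ p, (e (N + i)).d ((e (N + i)).par p)) (strictAnti_nat_of_succ_lt fun i => ?_)
  have hd := hconst (N + i) (by omega)
  obtain ⟨S, ⟨p, hp⟩, hS, hS'⟩ := hstep (N + i)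
  have hlt : ∀ q ∈ S, (e (N + i + 1)).d ((e (N + i + 1)).par q) <
      (e (N + i)).d ((e (N + i)).par q) := fun q hq =>
    improve _ _ q (hvalid _) (hS q hq).1 (hS q hq).2 hd
  refine Finset.sum_lt_sum (fun q _ => ?_) ⟨p, Finset.mem_univ p, hlt p hp⟩
  by_cases hq : q ∈ S
  · exact (hlt q hq).le
  · exact le_of_eq (by rw [← add_assoc, (hS' q hq).2, hd])

theorem algoB_terminates {V : Type*} [Fintype V] (G : SimpleGraph V) (r : V) (D : ℕ) :
    ¬ ∃ e : ℕ → Config V,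
      (∀ i, ValidB G r D (e i)) ∧ ∀ i, Step r (execB G D) (e i) (e (i + 1)) := by
  refine not_exists_infinite_execution
    (fun k γ p => p ≠ r ∧ γ.d p = k ∧ (k = D ∨ minD G γ p + 1 = k)) (fun _ _ _ h => h.2.1) ?_ ?_ ?_
  · rintro k γ γ' p hγ hγ' ⟨S, -, hS, hS'⟩ hfr hne hk
    have hp : p ∈ S := by
      by_contra hp
      exact hne ((hS' p hp).1 ▸ hk)
    obtain ⟨hpr, h⟩ := hS p hp
    refine ⟨hpr, hk, ?_⟩
    rcases h with h | h | h
    · have := hfr.minD_eq (hγ.2 p hpr).1 (by omega)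
      omega
    · omega
    · omega
  · rintro k γ γ' p hγ hγ' ⟨S, -, hS, hS'⟩ hfr ⟨hpr, hk, hmin⟩
    have hD := (hγ'.2 p hpr).2.2
    have hfp := hfr p
    rcases hmin with hkD | hmin
    · exact ⟨hpr, by omega, Or.inl hkD⟩
    · have hmin' := hfr.minD_eq (hγ.2 p hpr).1 (by omega)
      have hDk := (hγ.2 p hpr).2.2
      refine ⟨hpr, ?_, Or.inr (by omega)⟩
      by_cases hp : p ∈ S
      · rcases (hS p hp).2 with h | h | h
        · exact absurd (show γ.d p = minD G γ p + 1 by omega) h.2.1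
        · omega
        · omega
      · rw [(hS' p hp).1, hk]
  · rintro γ γ' p hγ hpr h hd
    have hle := minD_le_of_adj (γ := γ) (hγ.2 p hpr).1
    unfold execB dOk parOk at h
    rw [hd] at h ⊢
    omega

theorem algoHC_terminates {V : Type*} [Fintype V] (G : SimpleGraph V) (r : V) (D : ℕ) :
    ¬ ∃ e : ℕ → Config V,
      (∀ i, ValidB G r D (e i)) ∧ ∀ i, Step r (execHC G D) (e i) (e (i + 1)) := by
  refine not_exists_infinite_execution
    (fun k γ p => γ.d p = k ∧ γ.d (γ.par p) + 1 = k) (fun _ _ _ h => h.1) ?_ ?_ ?_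
  · rintro k γ γ' p hγ hγ' ⟨S, -, hS, hS'⟩ hfr hne hk
    have hp : p ∈ S := by
      by_contra hp
      exact hne ((hS' p hp).1 ▸ hk)
    refine ⟨hk, ?_⟩
    have hpar : γ.d (γ'.par p) + 1 = k := by
      rcases (hS p hp).2 with ⟨-, -, h₁, h₂⟩ | ⟨-, h₁, -, h₂⟩
      · rw [h₂]; omega
      · omega
    rw [hfr _ (Or.inl (by omega)), hpar]
  · rintro k γ γ' p hγ hγ' ⟨S, -, hS, hS'⟩ hfr ⟨hk, hpar⟩
    by_cases hp : p ∈ S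
    · rcases (hS p hp).2 with h | h
      · exact absurd (show γ.d p = γ.d (γ.par p) + 1 by omega) h.1
      · have := hfr p
        omega
    · obtain ⟨h₁, h₂⟩ := hS' p hp
      rw [h₁, h₂, hfr _ (Or.inl (by omega))]
      exact ⟨hk, hpar⟩
  · rintro γ γ' p hγ hpr h hd
    unfold execHC parOk at h
    rw [hd] at h ⊢
    omega

/-- For every `D ≥ 1`, under a distributed unfair daemon, every execution of
`Algo_B(D)` and every execution of `Algo_HC(D)` is finite: there is no infinite
sequence of configurations `γ_0, γ_1, …` linked by steps of the algorithm. -/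
theorem algoB_algoHC_terminate {V : Type*} [Fintype V]
    (G : SimpleGraph V) (hconn : G.Connected) (r : V) (D : ℕ) (hD : 1 ≤ D) :
    (¬ ∃ e : ℕ → Config V,
        (∀ i, ValidB G r D (e i)) ∧ ∀ i, Step r (execB G D) (e i) (e (i + 1))) ∧
    (¬ ∃ e : ℕ → Config V,
        (∀ i, ValidB G r D (e i)) ∧ ∀ i, Step r (execHC G D) (e i) (e (i + 1))) :=
  ⟨algoB_terminates G r D, algoHC_terminates G r D⟩
end

section
/- For every D ≥ 𝒟, the stabilization time of Algo_FHC(D) is at most 𝒟+1 rounds: every execution of Algo_FHC(D) reaches a terminal configuration within at most 𝒟+1 rounds. -/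
open SimpleGraph

section Graph

variable {V : Type*} {G : SimpleGraph V}

theorem minD_le {γ : Config V} {p q : V} (h : G.Adj p q) : minD G γ p ≤ γ.d q :=
  Nat.sInf_le ⟨q, h, rfl⟩

theorem exists_adj_d_eq_minD (γ : Config V) {p q : V} (h : G.Adj p q) :
    ∃ u, G.Adj p u ∧ γ.d u = minD G γ p := by
  obtain ⟨u, hu, h'⟩ := Nat.sInf_mem (s := γ.d '' {q | G.Adj p q}) ⟨_, q, h, rfl⟩
  exact ⟨u, hu, h'⟩

theorem SimpleGraph.Adj.dist_le_dist_add_one (hconn : G.Connected) (r : V) {p q : V}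
    (h : G.Adj p q) : G.dist r p ≤ G.dist r q + 1 := by
  have := hconn.dist_triangle (u := r) (v := q) (w := p)
  rwa [dist_eq_one_iff_adj.mpr h.symm] at this

theorem SimpleGraph.Connected.exists_adj_dist_add_one_eq (hconn : G.Connected) {r p : V}
    (h : p ≠ r) : ∃ q, G.Adj p q ∧ G.dist r q + 1 = G.dist r p := by
  obtain ⟨w, hw⟩ := hconn.exists_walk_length_eq_dist p r
  cases w with
  | nil => exact absurd rfl h
  | @cons _ q _ hpq w =>
    refine ⟨q, hpq, le_antisymm ?_ (hpq.dist_le_dist_add_one hconn r)⟩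
    rw [Walk.length_cons] at hw
    rw [dist_comm (u := r), dist_comm (u := r), ← hw]
    exact Nat.succ_le_succ (dist_le w)

theorem enabled_of_minD_lt {r : V} {D : ℕ} {γ : Config V} (hv : ValidB G r D γ)
    {p : V} (hp : p ≠ r) (hmin : minD G γ p < D) (hd : γ.d p ≠ minD G γ p + 1) :
    Enabled r (guardFHC G D) γ p := by
  have hle := minD_le (γ := γ) (hv.2 p hp).1
  refine ⟨hp, ?_⟩
  unfold guardFHC parOk
  omega

end Graph

section Execution

variable {V : Type*} {G : SimpleGraph V} {r : V} {D : ℕ} {e : ℕ → Config V} {M : ℕ → Set V}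

/-- The distance values are at least `min k (dist r p)` at every vertex. -/
def DistLowerBound (G : SimpleGraph V) (r : V) (k : ℕ) (γ : Config V) : Prop :=
  ∀ p, min k (G.dist r p) ≤ γ.d p

/-- Vertices within distance `k` of the root do not overestimate their distance. -/
def DistUpperBound (G : SimpleGraph V) (r : V) (k : ℕ) (γ : Config V) : Prop :=
  ∀ p, G.dist r p ≤ k → γ.d p ≤ G.dist r p

/-- Vertices farther than `k` with value `k` have a neighbor with value at most `k + 1`. -/
def LowVerticesSupported (G : SimpleGraph V) (r : V) (k : ℕ) (γ : Config V) : Prop :=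
  ∀ p, k < G.dist r p → γ.d p = k → ∃ q, G.Adj p q ∧ γ.d q ≤ k + 1

theorem IsExec.of_mem (h : IsExec r (ValidB G r D) (execFHC G D) (guardFHC G D) e M)
    {i : ℕ} {p : V} (hp : p ∈ M i) :
    p ≠ r ∧ (e (i + 1)).d p = minD G (e i) p + 1 ∧
      (e i).d ((e (i + 1)).par p) = minD G (e i) p := by
  rcases h.2 i with ⟨-, -, hM⟩ | hs
  · simp [hM] at hp
  · obtain ⟨hr, hx⟩ := hs.2.1 p hp
    refine ⟨hr, ?_⟩
    rcases hx with ⟨-, -, h1, h2, h3⟩ | ⟨-, h1, -, h2⟩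
    · rw [h3, h2, h1]; exact ⟨rfl, rfl⟩
    · exact ⟨h1, h2⟩

theorem IsExec.of_notMem (h : IsExec r (ValidB G r D) (execFHC G D) (guardFHC G D) e M)
    {i : ℕ} {p : V} (hp : p ∉ M i) :
    (e (i + 1)).d p = (e i).d p ∧ (e (i + 1)).par p = (e i).par p := by
  rcases h.2 i with ⟨-, he, -⟩ | hs
  · rw [he]; exact ⟨rfl, rfl⟩
  · exact hs.2.2 p hp

theorem IsExec.d_eq_of_forall_notMem
    (h : IsExec r (ValidB G r D) (execFHC G D) (guardFHC G D) e M) {s t : ℕ} {p : V}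
    (hst : s ≤ t) (hp : ∀ j, s ≤ j → j < t → p ∉ M j) : (e t).d p = (e s).d p := by
  induction t, hst using Nat.le_induction with
  | base => rfl
  | succ t hst ih =>
    rw [(h.of_notMem (hp t hst (Nat.lt_succ_self t))).1]
    exact ih fun j h1 h2 => hp j h1 (by omega)

/-- While `p` is not selected, a neighbor's value cannot rise above `d p + 1`. -/
theorem IsExec.d_le_of_adj_of_forall_notMem
    (h : IsExec r (ValidB G r D) (execFHC G D) (guardFHC G D) e M) {s t m : ℕ} {p q : V}
    (hst : s ≤ t) (hp : ∀ j, s ≤ j → j < t → p ∉ M j) (hadj : G.Adj p q)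
    (hpm : (e s).d p ≤ m) (hqm : (e s).d q ≤ m + 1) : (e t).d q ≤ m + 1 := by
  induction t, hst using Nat.le_induction with
  | base => exact hqm
  | succ t hst ih =>
    have hp' : ∀ j, s ≤ j → j < t → p ∉ M j := fun j h1 h2 => hp j h1 (by omega)
    by_cases hq : q ∈ M t
    · have := (h.of_mem hq).2.1
      have := minD_le (γ := e t) hadj.symm
      have := h.d_eq_of_forall_notMem hst hp'
      omega
    · rw [(h.of_notMem hq).1]
      exact ih hp'

theorem IsExec.d_le_of_adj_of_mem
    (h : IsExec r (ValidB G r D) (execFHC G D) (guardFHC G D) e M) {s t j m : ℕ} {p q : V}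
    (hp : ∀ j, s ≤ j → j < t → p ∉ M j) (hadj : G.Adj p q) (hpm : (e s).d p ≤ m)
    (hsj : s ≤ j) (hjt : j < t) (hq : q ∈ M j) : (e t).d q ≤ m + 1 := by
  have hj := h.d_eq_of_forall_notMem hsj fun i h1 h2 => hp i h1 (by omega)
  have hj' := (h.of_notMem (hp j hsj hjt)).1
  have hmin := minD_le (γ := e j) hadj.symm
  have hmem := (h.of_mem hq).2.1
  exact h.d_le_of_adj_of_forall_notMem (s := j + 1) hjt (fun i h1 h2 => hp i (by omega) h2)
    hadj (by omega) (by omega)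

theorem IsExec.exists_mem_of_forall_enabled {s t : ℕ} {p : V}
    (hR : RoundEnd r (guardFHC G D) e M s t)
    (hen : ∀ j, s ≤ j → j ≤ t → Enabled r (guardFHC G D) (e j) p) :
    ∃ j, s ≤ j ∧ j < t ∧ p ∈ M j := by
  obtain ⟨j, h1, h2, h3⟩ := hR.2.1 p (hen s le_rfl hR.1)
  refine ⟨j, h1, h2, h3.resolve_right fun h' => h'.2 (hen (j + 1) (by omega) h2)⟩

theorem minD_add_one_ge (hconn : G.Connected)
    (h : IsExec r (ValidB G r D) (execFHC G D) (guardFHC G D) e M) {i k : ℕ}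
    (hk : DistLowerBound G r k (e i)) {p : V} (hp : p ≠ r) :
    min (k + 1) (G.dist r p) ≤ minD G (e i) p + 1 := by
  obtain ⟨u, hu, hu'⟩ := exists_adj_d_eq_minD (e i) ((h.1 i).2 p hp).1
  have := hk u
  have := hu.dist_le_dist_add_one hconn r
  omega

theorem DistLowerBound.mono (hconn : G.Connected)
    (h : IsExec r (ValidB G r D) (execFHC G D) (guardFHC G D) e M) {s t k : ℕ}
    (hk : DistLowerBound G r k (e s)) (hst : s ≤ t) : DistLowerBound G r k (e t) := by
  induction t, hst using Nat.le_induction with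
  | base => exact hk
  | succ t hst ih =>
    intro p
    by_cases hp : p ∈ M t
    · have h1 := h.of_mem hp
      have := minD_add_one_ge hconn h ih h1.1
      omega
    · rw [(h.of_notMem hp).1]
      exact ih p

theorem min_dist_le_d_of_mem (hconn : G.Connected)
    (h : IsExec r (ValidB G r D) (execFHC G D) (guardFHC G D) e M) {s t j k : ℕ}
    (hk : DistLowerBound G r k (e s)) {p : V} (hsj : s ≤ j) (hjt : j < t) (hp : p ∈ M j) :
    min (k + 1) (G.dist r p) ≤ (e t).d p := by
  induction t, hjt using Nat.le_induction with
  | base =>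
    rw [(h.of_mem hp).2.1]
    exact minD_add_one_ge hconn h (hk.mono hconn h hsj) (h.of_mem hp).1
  | succ t hjt ih =>
    by_cases hp' : p ∈ M t
    · rw [(h.of_mem hp').2.1]
      exact minD_add_one_ge hconn h (hk.mono hconn h (by omega)) (h.of_mem hp').1
    · rwa [(h.of_notMem hp').1]

theorem minD_add_one_le (hconn : G.Connected) {k : ℕ} {γ : Config V}
    (hk : DistUpperBound G r k γ) {p : V} (hp : p ≠ r) (hpk : G.dist r p ≤ k + 1) :
    minD G γ p + 1 ≤ G.dist r p := by
  obtain ⟨u, hu, hu'⟩ := hconn.exists_adj_dist_add_one_eq hp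
  have := hk u (by omega)
  have := minD_le (γ := γ) hu
  omega

theorem DistUpperBound.mono (hconn : G.Connected)
    (h : IsExec r (ValidB G r D) (execFHC G D) (guardFHC G D) e M) {s t k : ℕ}
    (hk : DistUpperBound G r k (e s)) (hst : s ≤ t) : DistUpperBound G r k (e t) := by
  induction t, hst using Nat.le_induction with
  | base => exact hk
  | succ t hst ih =>
    intro p hpk
    by_cases hp : p ∈ M t
    · rw [(h.of_mem hp).2.1]
      exact minD_add_one_le hconn ih (h.of_mem hp).1 (by omega)
    · rw [(h.of_notMem hp).1]
      exact ih p hpk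

theorem d_le_dist_of_mem (hconn : G.Connected)
    (h : IsExec r (ValidB G r D) (execFHC G D) (guardFHC G D) e M) {s t j k : ℕ}
    (hk : DistUpperBound G r k (e s)) {p : V} (hpk : G.dist r p ≤ k + 1) (hsj : s ≤ j)
    (hjt : j < t) (hp : p ∈ M j) : (e t).d p ≤ G.dist r p := by
  induction t, hjt using Nat.le_induction with
  | base =>
    rw [(h.of_mem hp).2.1]
    exact minD_add_one_le hconn (hk.mono hconn h hsj) (h.of_mem hp).1 hpk
  | succ t hjt ih =>
    by_cases hp' : p ∈ M t
    · rw [(h.of_mem hp').2.1]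
      exact minD_add_one_le hconn (hk.mono hconn h (by omega)) (h.of_mem hp').1 hpk
    · rwa [(h.of_notMem hp').1]

theorem ne_root_of_dist_pos {p : V} (h : 0 < G.dist r p) : p ≠ r := by
  rintro rfl
  simp at h

theorem DistUpperBound.succ_of_roundEnd (hconn : G.Connected)
    (h : IsExec r (ValidB G r D) (execFHC G D) (guardFHC G D) e M) {s t k : ℕ} (hkD : k < D)
    (hR : RoundEnd r (guardFHC G D) e M s t) (hk : DistUpperBound G r k (e s)) :
    DistUpperBound G r (k + 1) (e t) := by
  intro p hpk
  rcases Nat.lt_or_ge k (G.dist r p) with hlt | hle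
  swap
  · exact hk.mono hconn h hR.1 p hle
  by_contra! hd
  have hp : p ≠ r := ne_root_of_dist_pos (G := G) (by omega)
  have hno : ∀ j, s ≤ j → j < t → p ∉ M j := fun j h1 h2 hj =>
    absurd (d_le_dist_of_mem hconn h hk hpk h1 h2 hj) (by omega)
  obtain ⟨j, h1, h2, h3⟩ := IsExec.exists_mem_of_forall_enabled (p := p) hR fun j h1 h2 => by
    have hj := h.d_eq_of_forall_notMem h1 fun i h3 h4 => hno i h3 (by omega)
    have ht := h.d_eq_of_forall_notMem hR.1 hno
    have := minD_add_one_le hconn (hk.mono hconn h h1) hp hpk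
    exact enabled_of_minD_lt (h.1 j) hp (by omega) (by omega)
  exact hno j h1 h2 h3

theorem DistLowerBound.succ_of_roundEnd (hconn : G.Connected)
    (h : IsExec r (ValidB G r D) (execFHC G D) (guardFHC G D) e M) {s t k : ℕ}
    (hdist : ∀ p, G.dist r p ≤ D) (hR : RoundEnd r (guardFHC G D) e M s t)
    (hk : DistLowerBound G r k (e s)) (hU : DistUpperBound G r k (e s))
    (hC : LowVerticesSupported G r k (e s)) : DistLowerBound G r (k + 1) (e t) := by
  intro p
  have hkt := hk.mono hconn h hR.1 p
  by_contra! hd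
  have hp : p ≠ r := ne_root_of_dist_pos (G := G) (by omega)
  have hpD := hdist p
  have hno : ∀ j, s ≤ j → j < t → p ∉ M j := fun j h1 h2 hj =>
    absurd (min_dist_le_d_of_mem hconn h hk h1 h2 hj) (by omega)
  have ht := h.d_eq_of_forall_notMem hR.1 hno
  obtain ⟨j, h1, h2, h3⟩ := IsExec.exists_mem_of_forall_enabled (p := p) hR fun j h1 h2 => by
    have hno' : ∀ i, s ≤ i → i < j → p ∉ M i := fun i h3 h4 => hno i h3 (by omega)
    have hj := h.d_eq_of_forall_notMem h1 hno'
    have hge := minD_add_one_ge hconn h (hk.mono hconn h h1) hp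
    refine enabled_of_minD_lt (h.1 j) hp ?_ (by omega)
    rcases Nat.lt_or_ge (k + 1) (G.dist r p) with hlt | hle
    · obtain ⟨q, hq, hq'⟩ := hC p (by omega) (by omega)
      have := h.d_le_of_adj_of_forall_notMem h1 hno' hq (m := k) (by omega) hq'
      have := minD_le (γ := e j) hq
      omega
    · have := minD_add_one_le hconn (hU.mono hconn h h1) hp hle
      omega
  exact hno j h1 h2 h3

theorem exists_last_mem {p : V} {s t : ℕ} (h : ∃ j, s ≤ j ∧ j < t ∧ p ∈ M j) :
    ∃ j, s ≤ j ∧ j < t ∧ p ∈ M j ∧ ∀ i, j + 1 ≤ i → i < t → p ∉ M i := by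
  classical
  obtain ⟨j, h1, h2, h3⟩ := h
  have hP := Nat.findGreatest_spec (P := fun j => s ≤ j ∧ j < t ∧ p ∈ M j) h2.le ⟨h1, h2, h3⟩
  exact ⟨_, hP.1, hP.2.1, hP.2.2, fun i hi hit hmem =>
    Nat.findGreatest_is_greatest hi hit.le ⟨by omega, hit, hmem⟩⟩

theorem LowVerticesSupported.succ_of_roundEnd (hconn : G.Connected)
    (h : IsExec r (ValidB G r D) (execFHC G D) (guardFHC G D) e M) {s t k : ℕ}
    (hdist : ∀ p, G.dist r p ≤ D) (hR : RoundEnd r (guardFHC G D) e M s t)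
    (hk : DistLowerBound G r k (e s)) (hC : LowVerticesSupported G r k (e s)) :
    LowVerticesSupported G r (k + 1) (e t) := by
  intro p hpk hpd
  have hp : p ≠ r := ne_root_of_dist_pos (G := G) (by omega)
  have hpD := hdist p
  by_contra! hfar
  by_cases hex : ∃ j, s ≤ j ∧ j < t ∧ p ∈ M j
  · obtain ⟨j, h1, h2, h3, hlast⟩ := exists_last_mem hex
    have hj := h.d_eq_of_forall_notMem (s := j + 1) h2 hlast
    have hmem := (h.of_mem h3).2.1
    obtain ⟨q, hq, hqd⟩ := exists_adj_d_eq_minD (e j) ((h.1 j).2 p hp).1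
    have hqdist := hq.dist_le_dist_add_one hconn r
    have hqno : ∀ i, s ≤ i → i < j → q ∉ M i := fun i h4 h5 hi =>
      absurd (min_dist_le_d_of_mem hconn h hk h4 h5 hi) (by omega)
    have hqs := h.d_eq_of_forall_notMem h1 hqno
    obtain ⟨u, hu, hud⟩ := hC q (by omega) (by omega)
    have hu' := h.d_le_of_adj_of_forall_notMem h1 hqno hu (m := k) (by omega) hud
    have hqmin := minD_le (γ := e j) hu
    have hq1 : (e (j + 1)).d q ≤ k + 1 + 1 := by
      by_cases hqj : q ∈ M j
      · have := (h.of_mem hqj).2.1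
        omega
      · have := (h.of_notMem hqj).1
        omega
    have := h.d_le_of_adj_of_forall_notMem (s := j + 1) h2 hlast hq (m := k + 1) (by omega) hq1
    exact absurd (hfar q hq) (by omega)
  · push Not at hex
    obtain ⟨q, hq⟩ : ∃ q, G.Adj p q := ⟨_, ((h.1 t).2 p hp).1⟩
    have hps := h.d_eq_of_forall_notMem hR.1 hex
    have hqfar := hfar q hq
    have hqr : q ≠ r := ne_root_of_dist_pos (G := G) (by
      have := hq.dist_le_dist_add_one hconn r
      omega)
    have hqno : ∀ j, s ≤ j → j < t → q ∉ M j := fun j h1 h2 hj =>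
      absurd (h.d_le_of_adj_of_mem hex hq (m := k + 1) (by omega) h1 h2 hj) (by omega)
    have hqt := h.d_eq_of_forall_notMem hR.1 hqno
    obtain ⟨j, h1, h2, h3⟩ := IsExec.exists_mem_of_forall_enabled (p := q) hR fun j h1 h2 => by
      have hpj := h.d_eq_of_forall_notMem h1 fun i h3 h4 => hex i h3 (by omega)
      have hqj := h.d_eq_of_forall_notMem h1 fun i h3 h4 => hqno i h3 (by omega)
      have := minD_le (γ := e j) hq.symm
      exact enabled_of_minD_lt (h.1 j) hqr (by omega) (by omega)
    exact hqno j h1 h2 h3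

theorem bounds_of_rounds (hconn : G.Connected)
    (h : IsExec r (ValidB G r D) (execFHC G D) (guardFHC G D) e M)
    (hdist : ∀ p, G.dist r p ≤ D) {ix : ℕ → ℕ} {k : ℕ} (hkD : k ≤ D)
    (hround : ∀ i < k, RoundEnd r (guardFHC G D) e M (ix i) (ix (i + 1))) :
    DistLowerBound G r k (e (ix k)) ∧ DistUpperBound G r k (e (ix k)) ∧
      LowVerticesSupported G r k (e (ix k)) := by
  induction k with
  | zero =>
    refine ⟨fun p => by simp, fun p hp => ?_, fun p hp hd => ?_⟩
    · have hpr : r = p := hconn.dist_eq_zero_iff.mp (by omega)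
      rw [← hpr, (h.1 _).1]
      exact Nat.zero_le _
    · have := ((h.1 (ix 0)).2 p (ne_root_of_dist_pos hp)).2.1
      omega
  | succ k ih =>
    obtain ⟨h1, h2, h3⟩ := ih (by omega) fun i hi => hround i (by omega)
    have hR := hround k (by omega)
    exact ⟨h1.succ_of_roundEnd hconn h hdist hR h2 h3, h2.succ_of_roundEnd hconn h hkD hR,
      h3.succ_of_roundEnd hconn h hdist hR h1⟩

theorem not_enabled_iff_of_d_eq_dist (hconn : G.Connected) {γ : Config V}
    (hv : ValidB G r D γ) (hd : ∀ p, γ.d p = G.dist r p) {p : V} (hp : p ≠ r) :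
    ¬ Enabled r (guardFHC G D) γ p ↔ G.dist r (γ.par p) + 1 = G.dist r p := by
  have hpar := (hv.2 p hp).1
  have hmin : minD G γ p + 1 = G.dist r p := by
    obtain ⟨u, hu, hu'⟩ := hconn.exists_adj_dist_add_one_eq hp
    obtain ⟨v, hv, hv'⟩ := exists_adj_d_eq_minD γ hpar
    have := minD_le (γ := γ) hu
    have := hv.dist_le_dist_add_one hconn r
    rw [hd] at *
    omega
  have := minD_le (γ := γ) hpar
  unfold Enabled guardFHC parOk
  simp only [hd] at *
  simp only [ne_eq, hp, not_false_eq_true, true_and]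
  omega

theorem not_enabled_mono (hconn : G.Connected)
    (h : IsExec r (ValidB G r D) (execFHC G D) (guardFHC G D) e M) {s t : ℕ}
    (hd : ∀ i, s ≤ i → ∀ p, (e i).d p = G.dist r p) (hst : s ≤ t) {p : V} (hp : p ≠ r)
    (hdis : ¬ Enabled r (guardFHC G D) (e s) p) : ¬ Enabled r (guardFHC G D) (e t) p := by
  induction t, hst using Nat.le_induction with
  | base => exact hdis
  | succ t hst ih =>
    rw [not_enabled_iff_of_d_eq_dist hconn (h.1 _) (hd _ (by omega)) hp] at ih ⊢
    by_cases hpt : p ∈ M t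
    · obtain ⟨-, h1, h2⟩ := h.of_mem hpt
      rw [hd _ (by omega)] at h1 h2
      omega
    · rwa [(h.of_notMem hpt).2]

theorem terminal_of_roundEnd (hconn : G.Connected)
    (h : IsExec r (ValidB G r D) (execFHC G D) (guardFHC G D) e M) {s t : ℕ}
    (hd : ∀ i, s ≤ i → ∀ p, (e i).d p = G.dist r p)
    (hR : RoundEnd r (guardFHC G D) e M s t) : Terminal r (guardFHC G D) (e t) := by
  intro p hen
  have hp := hen.1
  by_cases hs : Enabled r (guardFHC G D) (e s) p
  · obtain ⟨j, h1, h2, h3⟩ := hR.2.1 p hs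
    refine not_enabled_mono hconn h (s := j + 1) (fun i hi => hd i (by omega)) h2 hp ?_ hen
    rcases h3 with h3 | h3
    · obtain ⟨-, h4, h5⟩ := h.of_mem h3
      rw [not_enabled_iff_of_d_eq_dist hconn (h.1 _) (hd _ (by omega)) hp]
      rw [hd _ (by omega)] at h4 h5
      omega
    · exact h3.2
  · exact not_enabled_mono hconn h hd hR.1 hp hs hen

end Execution

/-- For every `D ≥ 𝒟`, the stabilization time of `Algo_FHC(D)` is at most `𝒟 + 1`
rounds: along any execution, if `ix 0 = 0` and `ix (k+1)` is the end of the round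
starting at `ix k` for every `k < 𝒟 + 1`, then the configuration reached at the end of
the `(𝒟+1)`-st round is terminal. -/
theorem algoFHC_stabilizes_in_diam_add_one_rounds {V : Type*} [Fintype V]
    (G : SimpleGraph V) (hconn : G.Connected) (r : V) (D : ℕ) (hD : G.diam ≤ D)
    (e : ℕ → Config V) (M : ℕ → Set V) (ix : ℕ → ℕ)
    (hexec : IsExec r (ValidB G r D) (execFHC G D) (guardFHC G D) e M)
    (hix0 : ix 0 = 0)
    (hround : ∀ k < G.diam + 1, RoundEnd r (guardFHC G D) e M (ix k) (ix (k + 1))) :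
    Terminal r (guardFHC G D) (e (ix (G.diam + 1))) := by
  have : Nonempty V := ⟨r⟩
  have hdiam : ∀ p, G.dist r p ≤ G.diam := fun p =>
    dist_le_diam (connected_iff_ediam_ne_top.mp hconn)
  obtain ⟨hL, hU, -⟩ := bounds_of_rounds hconn hexec (fun p => (hdiam p).trans hD) hD
    fun i hi => hround i (by omega)
  refine terminal_of_roundEnd hconn hexec (fun i hi p => ?_) (hround _ (Nat.lt_succ_self _))
  have h1 := hL.mono hconn hexec hi p
  have h2 := hU.mono hconn hexec hi p (hdiam p)
  have h3 := hdiam p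
  omega
end

section
/- The stabilization time in steps of Algo_U cannot be bounded by any function of the network topology: on the fixed 5-vertex line graph L5 with vertices r, p1, p2, p3, p4 and edges {r,p1}, {p1,p2}, {p2,p3}, {p3,p4}, rooted at r, for every B ∈ ℕ there exists a sequence of configurations γ_0 ↦ γ_1 ↦ … ↦ γ_m of Algo_U with m > B in which no configuration γ_0,…,γ_{m-1} is terminal. -/
open SimpleGraph

/-- The 5-vertex line graph with vertices `0 = r, 1, 2, 3, 4` and edges `{i, i+1}`. -/
def L5 : SimpleGraph (Fin 5) :=
  SimpleGraph.fromRel (fun i j => (j : ℕ) = (i : ℕ) + 1)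

/-- A neighbor whose `d`-value bounds those of all neighbors from below attains `minD`. -/
theorem minD_eq_of_forall_le {V : Type*} {G : SimpleGraph V} {γ : Config V} {p q : V}
    (hq : G.Adj p q) (hle : ∀ q', G.Adj p q' → γ.d q ≤ γ.d q') : minD G γ p = γ.d q :=
  IsLeast.csInf_eq ⟨⟨q, hq, rfl⟩, by rintro _ ⟨q', hq', rfl⟩; exact hle q' hq'⟩

/-- The vertex `1` holds the stale value `K`; the vertices `2`, `3`, `4` hold the common
value `i`. -/
def countingConfig (K i : ℕ) : Config (Fin 5) where
  d := ![0, K, i, i, i]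
  par := ![1, 0, 3, 2, 3]

theorem adj_countingConfig_par (K i : ℕ) (p : Fin 5) : L5.Adj p ((countingConfig K i).par p) := by
  fin_cases p <;> simp [L5, countingConfig, SimpleGraph.fromRel_adj]

theorem countingConfig_d_of_two_le (K i : ℕ) {p : Fin 5} (hp : 2 ≤ p) :
    (countingConfig K i).d p = i := by
  fin_cases p <;> first | rfl | exact absurd hp (by decide)

theorem countingConfig_d_par (K i : ℕ) {p : Fin 5} (hp : 2 ≤ p) :
    (countingConfig K i).d ((countingConfig K i).par p) = i := by
  fin_cases p <;> first | rfl | exact absurd hp (by decide)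

theorem minD_countingConfig {K i : ℕ} (hi : i ≤ K) {p : Fin 5} (hp : 2 ≤ p) :
    minD L5 (countingConfig K i) p = i := by
  have hpar := countingConfig_d_par K i hp
  rw [minD_eq_of_forall_le (adj_countingConfig_par K i p), hpar]
  intro q hq
  rw [hpar]
  by_cases h0 : q = 0
  · subst h0
    simp only [L5, SimpleGraph.fromRel_adj, Fin.le_def] at hq hp
    simp at hq hp
    omega
  · fin_cases q <;> simp_all [countingConfig]

theorem not_dOk_countingConfig {K i : ℕ} (hi : i ≤ K) {p : Fin 5} (hp : 2 ≤ p) :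
    ¬ dOk L5 (countingConfig K i) p := by
  rw [dOk, minD_countingConfig hi hp, countingConfig_d_of_two_le K i hp]
  omega

theorem step_countingConfig {K i : ℕ} (hi : i ≤ K) :
    Step (0 : Fin 5) (execU L5) (countingConfig K i) (countingConfig K (i + 1)) := by
  refine ⟨{p | 2 ≤ p}, ⟨2, le_refl (2 : Fin 5)⟩, fun p hp => ⟨?_, Or.inl ⟨?_, ?_, ?_, ?_⟩⟩,
    fun p hp => ⟨?_, rfl⟩⟩
  · rintro rfl
    exact absurd hp (by decide)
  · exact not_dOk_countingConfig hi hp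
  · rw [minD_countingConfig hi hp, countingConfig_d_of_two_le K (i + 1) hp]
  · exact adj_countingConfig_par K (i + 1) p
  · rw [minD_countingConfig hi hp]
    exact countingConfig_d_par K i hp
  · fin_cases p <;> first | rfl | exact absurd (by decide) hp

/-- The stabilization time in steps of `Algo_U` cannot be bounded by any function of
the network topology: on the fixed line `L5` rooted at `0`, for every `B` there is a
sequence of configurations `γ_0 ↦ … ↦ γ_m` of `Algo_U` with `m > B` in which no
configuration `γ_0, …, γ_{m-1}` is terminal. -/
theorem algoU_steps_unbounded (B : ℕ) :
    ∃ (m : ℕ) (γ : ℕ → Config (Fin 5)),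
      B < m ∧
      (∀ i ≤ m, ValidU L5 0 (γ i)) ∧
      (∀ i < m, Step (0 : Fin 5) (execU L5) (γ i) (γ (i + 1))) ∧
      (∀ j < m, ¬ Terminal (0 : Fin 5) (guardU L5) (γ j)) := by
  refine ⟨B + 1, countingConfig (B + 1), Nat.lt_succ_self B, fun i _ => ⟨rfl, fun p _ => ?_⟩,
    fun i hi => step_countingConfig hi.le, fun j hj hT => ?_⟩
  · exact adj_countingConfig_par (B + 1) i p
  · exact hT 2 ⟨by decide, Or.inl (not_dOk_countingConfig hj.le (le_refl 2))⟩
end
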